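/- Second inequality of Lemma 1: Fix 0 < s̲ ≤ s̄ ≤ 2, A > 0, β' > 0, δ > β' and c > 2β'. For each integer n ≥ 3 let σ(n), τ(n) ∈ [s̲, s̄] satisfy τ(n) − σ(n) ≥ c/log n, and set u_n = ( (log n)/2 − (δ/τ(n))·log log n )^{1/τ(n)}. Then e^{u_n^{τ(n)}} · ( A u_n^{−β'} e^{−u_n^{σ(n)}} − e^{−u_n^{τ(n)}} ) → +∞ as n → ∞; in particular, eventually (1/2)( A u_n^{−β'} e^{−u_n^{σ(n)}} − e^{−u_n^{τ(n)}} ) ≥ (1/2) e^{−u_n^{τ(n)}} (1 + o(1)). -/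

import Mathlib

open Filter Real

/-- Second inequality of Lemma 1 (Butucea–Matias–Pouet): with grid points
`σ n < τ n` in `[s̲, s̄] ⊆ (0, 2]` separated by at least `c / log n` (`c > 2β'`),
and `u_n = ((log n)/2 - (δ/τ n) log log n)^{1/τ n}` with `δ > β'`, one has
`e^{u_n^{τ n}} (A u_n^{-β'} e^{-u_n^{σ n}} - e^{-u_n^{τ n}}) → +∞`, i.e.
`(1/2)(A u_n^{-β'} e^{-u_n^{σ n}} - e^{-u_n^{τ n}}) ≥ (1/2) e^{-u_n^{τ n}} (1 + o(1))`. -/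
theorem lemma1_second_inequality
    (sl sb A β' δ c : ℝ)
    (hsl : 0 < sl) (hslb : sl ≤ sb) (hsb : sb ≤ 2)
    (hA : 0 < A) (hβ' : 0 < β') (hδ : β' < δ) (hc : 2 * β' < c)
    (σ τ : ℕ → ℝ)
    (hσ : ∀ n : ℕ, 3 ≤ n → σ n ∈ Set.Icc sl sb)
    (hτ : ∀ n : ℕ, 3 ≤ n → τ n ∈ Set.Icc sl sb)
    (hgap : ∀ n : ℕ, 3 ≤ n → c / Real.log n ≤ τ n - σ n)
    (u : ℕ → ℝ)
    (hu : ∀ n : ℕ, 3 ≤ n →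
      u n = (Real.log n / 2 - (δ / τ n) * Real.log (Real.log n)) ^ (1 / τ n)) :
    Tendsto
      (fun n : ℕ =>
        Real.exp ((u n) ^ (τ n)) *
          (A * (u n) ^ (-β') * Real.exp (-(u n) ^ (σ n)) - Real.exp (-(u n) ^ (τ n))))
      atTop atTop := by
  set κ : ℝ := (c / 2 + β') / 2 with hκ
  have hκ1 : β' < κ := by rw [hκ]; linarith
  have hκ2 : κ < c / 2 := by rw [hκ]; linarith
  have hcpos : 0 < c := by linarith
  have hδpos : 0 < δ := by linarith
  have hL : Tendsto (fun n : ℕ => Real.log n) atTop atTop :=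
    Real.tendsto_log_atTop.comp tendsto_natCast_atTop_atTop
  have hr0 : Tendsto (fun x : ℝ => Real.log x / x) atTop (nhds 0) :=
    Real.isLittleO_log_id_atTop.tendsto_div_nhds_zero
  have hr : Tendsto (fun n : ℕ => Real.log (Real.log n) / Real.log n) atTop (nhds 0) :=
    hr0.comp hL
  have hlow : Tendsto (fun n : ℕ =>
      A * Real.exp ((κ - β') / 2 * Real.log (Real.log n / 4)) - 1) atTop atTop := by
    apply tendsto_atTop_add_const_right
    apply Tendsto.const_mul_atTop hA
    apply Real.tendsto_exp_atTop.comp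
    apply Tendsto.const_mul_atTop (by linarith)
    exact Real.tendsto_log_atTop.comp (hL.atTop_div_const (by norm_num))
  have hcond1 : ∀ᶠ n : ℕ in atTop,
      (δ / sl) * (Real.log (Real.log n) / Real.log n) < 1 / 4 := by
    have h := hr.const_mul (δ / sl)
    rw [mul_zero] at h
    exact h.eventually_lt_const (by norm_num)
  have hcond2 : ∀ᶠ n : ℕ in atTop,
      (c * δ / sl + κ * c / sl) * (Real.log (Real.log n) / Real.log n) < c / 2 - κ := by
    have h := hr.const_mul (c * δ / sl + κ * c / sl)
    rw [mul_zero] at h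
    exact h.eventually_lt_const (by linarith)
  refine tendsto_atTop_mono' _ ?_ hlow
  filter_upwards [hcond1, hcond2, hL.eventually_ge_atTop 5, eventually_ge_atTop 3]
    with n h1 h2 h5 hn
  obtain ⟨hτ1, hτ2⟩ := hτ n hn
  have hg := hgap n hn
  have hun := hu n hn
  set L := Real.log (n : ℝ) with hLdef
  set t := τ n
  set s := σ n
  have ht : 0 < t := by linarith
  have hLpos : 0 < L := by linarith
  have hlogL : 0 < Real.log L := Real.log_pos (by linarith)
  set r := Real.log L / L with hrdef
  have hrL : Real.log L = r * L := by rw [hrdef]; field_simp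
  have hrpos : 0 < r := by positivity
  set v := L / 2 - (δ / t) * Real.log L with hv
  have hdt : δ / t ≤ δ / sl := by gcongr
  have hvlow : L / 2 - (δ / sl) * r * L ≤ v := by
    rw [hv, hrL]
    have := mul_le_mul_of_nonneg_right hdt (by positivity : 0 ≤ r * L)
    linarith
  have hv4 : L / 4 ≤ v := by
    have := mul_lt_mul_of_pos_right h1 hLpos
    linarith
  have hvL : v ≤ L := by
    have : 0 ≤ (δ / t) * Real.log L := by positivity
    linarith
  have hv1 : 1 < v := by linarith
  have hvpos : 0 < v := by linarith
  have hupos : 0 < u n := by rw [hun]; positivity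
  have hut : u n ^ t = v := by
    rw [hun, ← Real.rpow_mul hvpos.le, one_div, inv_mul_cancel₀ ht.ne', Real.rpow_one]
  set l := Real.log (u n) with hl
  have hlv : l = Real.log v / t := by
    rw [hl, hun, Real.log_rpow hvpos]; ring
  have hlogv : 0 < Real.log v := Real.log_pos hv1
  have hlpos : 0 < l := by rw [hlv]; positivity
  have hl_low : Real.log (L / 4) / 2 ≤ l := by
    rw [hlv]
    have ha : Real.log (L / 4) ≤ Real.log v := Real.log_le_log (by positivity) hv4
    calc Real.log (L / 4) / 2 ≤ Real.log v / 2 := by gcongr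
      _ ≤ Real.log v / t := by
        apply div_le_div_of_nonneg_left hlogv.le ht (by linarith)
  have hl_up : l ≤ r * L / sl := by
    rw [hlv, ← hrL]
    have ha : Real.log v ≤ Real.log L := Real.log_le_log hvpos hvL
    gcongr
  set x := c / L * l with hx
  have hxpos : 0 < x := by positivity
  have hxup : x ≤ c * r / sl := by
    calc x ≤ c / L * (r * L / sl) := by rw [hx]; gcongr
      _ = c * r / sl := by field_simp
  have hus : u n ^ s ≤ v / (1 + x) := by
    have e1 : u n ^ s = v * Real.exp (-((t - s) * l)) := by
      rw [← hut, Real.rpow_def_of_pos hupos, Real.rpow_def_of_pos hupos, ← Real.exp_add]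
      congr 1; ring
    have e2 : Real.exp (-((t - s) * l)) ≤ Real.exp (-x) := by
      apply Real.exp_le_exp.2
      have := mul_le_mul_of_nonneg_right hg hlpos.le
      linarith
    have e3 : Real.exp (-x) ≤ 1 / (1 + x) := by
      rw [Real.exp_neg, ← one_div]
      apply one_div_le_one_div_of_le (by linarith)
      linarith [Real.add_one_le_exp x]
    rw [e1, div_eq_mul_one_div]
    exact mul_le_mul_of_nonneg_left (e2.trans e3) hvpos.le
  have hkey : κ * l ≤ v - v / (1 + x) := by
    have e1 : v - v / (1 + x) = (v * (c / L)) * l / (1 + x) := by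
      rw [mul_assoc, ← hx]; field_simp; ring
    rw [e1, le_div_iff₀ (by linarith)]
    have e2 : c / 2 - c * δ / sl * r ≤ v * (c / L) := by
      calc c / 2 - c * δ / sl * r = (L / 2 - (δ / sl) * r * L) * (c / L) := by field_simp
        _ ≤ v * (c / L) := by gcongr
    have e3 : κ * (1 + x) ≤ κ + κ * c / sl * r := by
      have : κ * x ≤ κ * (c * r / sl) := mul_le_mul_of_nonneg_left hxup (by linarith)
      calc κ * (1 + x) = κ + κ * x := by ring
        _ ≤ κ + κ * (c * r / sl) := by linarith
        _ = _ := by ring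
    have e4 : κ * (1 + x) ≤ v * (c / L) := by linarith
    have := mul_le_mul_of_nonneg_right e4 hlpos.le
    linarith
  have hE : Real.exp (u n ^ t) *
      (A * u n ^ (-β') * Real.exp (-(u n) ^ s) - Real.exp (-(u n) ^ t)) =
      A * Real.exp (v - u n ^ s - β' * l) - 1 := by
    rw [hut, mul_sub, ← Real.exp_add v (-v), add_neg_cancel, Real.exp_zero,
      Real.rpow_def_of_pos hupos (-β'),
      show v - u n ^ s - β' * l = v + (l * -β' + -(u n ^ s)) by ring,
      Real.exp_add, Real.exp_add]
    ring
  rw [hE]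
  have hfin : (κ - β') / 2 * Real.log (L / 4) ≤ v - u n ^ s - β' * l := by
    have := mul_le_mul_of_nonneg_left hl_low (by linarith : 0 ≤ κ - β')
    linarith
  have := mul_le_mul_of_nonneg_left (Real.exp_le_exp.2 hfin) hA.le
  linarith
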